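/- The lattices U ⊕ U ⊕ U ⊕ Γ₁₆(−1) and U ⊕ U ⊕ U ⊕ E8(−1) ⊕ E8(−1) are isometric. -/

import Mathlib

open Matrix Finset
/-- The lattice `Γ₁₆ = {x ∈ ℚ^16 : 2xᵢ ∈ ℤ, xᵢ - xⱼ ∈ ℤ, ∑ xᵢ ∈ 2ℤ}`. -/
def Gamma16 : Submodule ℤ (Fin 16 → ℚ) where
  carrier := {x | (∀ i, ∃ k : ℤ, 2 * x i = k) ∧ (∀ i j, ∃ k : ℤ, x i - x j = k) ∧
    ∃ k : ℤ, ∑ i, x i = 2 * k}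
  add_mem' := by
    rintro a b ⟨ha1, ha2, ka, hka⟩ ⟨hb1, hb2, kb, hkb⟩
    refine ⟨fun i => ?_, fun i j => ?_, ⟨ka + kb, ?_⟩⟩
    · obtain ⟨k, hk⟩ := ha1 i
      obtain ⟨l, hl⟩ := hb1 i
      exact ⟨k + l, by rw [Pi.add_apply, mul_add, hk, hl]; push_cast; ring⟩
    · obtain ⟨k, hk⟩ := ha2 i j
      obtain ⟨l, hl⟩ := hb2 i j
      refine ⟨k + l, ?_⟩
      rw [Pi.add_apply, Pi.add_apply]
      push_cast
      rw [← hk, ← hl]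
      ring
    · simp only [Pi.add_apply, Finset.sum_add_distrib, hka, hkb]
      push_cast
      ring
  zero_mem' := ⟨fun i => ⟨0, by simp⟩, fun i j => ⟨0, by simp⟩, ⟨0, by simp⟩⟩
  smul_mem' := by
    rintro c a ⟨ha1, ha2, ka, hka⟩
    refine ⟨fun i => ?_, fun i j => ?_, ⟨c * ka, ?_⟩⟩
    · obtain ⟨k, hk⟩ := ha1 i
      refine ⟨c * k, ?_⟩
      rw [Pi.smul_apply, zsmul_eq_mul]
      push_cast
      rw [mul_left_comm, hk]
    · obtain ⟨k, hk⟩ := ha2 i j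
      refine ⟨c * k, ?_⟩
      rw [Pi.smul_apply, Pi.smul_apply, zsmul_eq_mul, zsmul_eq_mul]
      push_cast
      rw [← mul_sub, hk]
    · simp only [Pi.smul_apply, zsmul_eq_mul, ← Finset.mul_sum, hka]
      push_cast
      ring


/-- The hyperbolic plane `U`: bilinear form on `ℤ²` with Gram matrix `[[0,1],[1,0]]`. -/
def bU (x y : Fin 2 → ℤ) : ℤ := x 0 * y 1 + x 1 * y 0

/-- The bilinear form of `E8(-1)`: the negative of the E8 Cartan matrix pairing. -/
def bE8 (x y : Fin 8 → ℤ) : ℤ := -(x ⬝ᵥ (CartanMatrix.E₈ *ᵥ y))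

/-- The underlying module of `U ⊕ U ⊕ U ⊕ Γ₁₆(-1)`. -/
abbrev AT : Type := (Fin 3 → Fin 2 → ℤ) × Gamma16

/-- The bilinear form of `U ⊕ U ⊕ U ⊕ Γ₁₆(-1)` (with values in `ℚ`). -/
def bA (x y : AT) : ℚ :=
  ((∑ i : Fin 3, bU (x.1 i) (y.1 i) : ℤ) : ℚ) +
    (-(∑ i, (x.2 : Fin 16 → ℚ) i * (y.2 : Fin 16 → ℚ) i))

/-- The underlying `ℤ`-module of `U ⊕ U ⊕ U ⊕ E8(-1) ⊕ E8(-1)`. -/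
abbrev BT : Type := (Fin 3 → Fin 2 → ℤ) × (Fin 8 → ℤ) × (Fin 8 → ℤ)

/-- The bilinear form of `U ⊕ U ⊕ U ⊕ E8(-1) ⊕ E8(-1)`. -/
def bB (x y : BT) : ℤ :=
  (∑ i : Fin 3, bU (x.1 i) (y.1 i)) + bE8 x.2.1 y.2.1 + bE8 x.2.2 y.2.2

/-- The `Γ₁₆`-coordinates of the embedding of `U ⊕ E8(-1) ⊕ E8(-1)` into `U ⊕ Γ₁₆(-1)`
given by the two `E8` subdiagrams of the Coxeter diagram of the even unimodular lattice of
signature `(1, 17)`. -/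
def gammaCoord (u : Fin 2 → ℤ) (p q : Fin 8 → ℤ) : Fin 16 → ℤ :=
  ![-u 0 - u 1 - p 2 + p 1, -u 0 - u 1 - p 2 - p 1 + p 3, -u 0 - u 1 - p 3 + p 4,
    -u 0 - u 1 - p 4 + p 5, -u 0 - u 1 - p 5 + p 6, -u 0 - u 1 - p 6 + p 7,
    -u 0 - u 1 - p 7, -u 0, -u 1, q 7, -q 7 + q 6, -q 6 + q 5, -q 5 + q 4, -q 4 + q 3,
    -q 3 + q 1 + q 2, -q 1 + q 2]

/-- The hyperbolic coordinates of the same embedding. -/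
def hypCoord (u : Fin 2 → ℤ) (p q : Fin 8 → ℤ) : Fin 2 → ℤ :=
  ![2 * (u 0 + u 1) - p 0 + p 2 + q 0, 2 * (u 0 + u 1) + p 0 + q 0]

lemma gammaCoord_sub_half_mem (u : Fin 2 → ℤ) (p q : Fin 8 → ℤ) :
    (fun i => (gammaCoord u p q i : ℚ) - q 0 / 2) ∈ Gamma16 := by
  refine ⟨fun i => ⟨2 * gammaCoord u p q i - q 0, ?_⟩,
    fun i j => ⟨gammaCoord u p q i - gammaCoord u p q j, ?_⟩,
    ⟨-4 * (u 0 + u 1) - p 2 + q 2 - 4 * q 0, ?_⟩⟩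
  · push_cast; ring
  · push_cast; ring
  · simp only [Fin.sum_univ_succ, gammaCoord]
    simp
    ring

/-- The isometry from `U ⊕ U ⊕ U ⊕ E8(-1) ⊕ E8(-1)` to `U ⊕ U ⊕ U ⊕ Γ₁₆(-1)`
as a linear map. -/
def e8e8ToGamma16 : BT →ₗ[ℤ] AT where
  toFun x := (![hypCoord (x.1 0) x.2.1 x.2.2, x.1 1, x.1 2],
    ⟨_, gammaCoord_sub_half_mem (x.1 0) x.2.1 x.2.2⟩)
  map_add' x y := by
    refine Prod.ext ?_ (Subtype.ext ?_)
    · ext i j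
      fin_cases i <;> fin_cases j <;> simp [hypCoord] <;> ring
    · ext i
      fin_cases i <;> simp [gammaCoord] <;> ring
  map_smul' c x := by
    refine Prod.ext ?_ (Subtype.ext ?_)
    · ext i j
      fin_cases i <;> fin_cases j <;> simp [hypCoord] <;> ring
    · ext i
      fin_cases i <;> simp [gammaCoord] <;> ring

lemma bE8_eq (x y : Fin 8 → ℤ) : bE8 x y =
    -(2 * (x 0 * y 0 + x 1 * y 1 + x 2 * y 2 + x 3 * y 3 + x 4 * y 4 + x 5 * y 5 + x 6 * y 6
      + x 7 * y 7) - (x 0 * y 2 + x 2 * y 0) - (x 1 * y 3 + x 3 * y 1) - (x 2 * y 3 + x 3 * y 2)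
      - (x 3 * y 4 + x 4 * y 3) - (x 4 * y 5 + x 5 * y 4) - (x 5 * y 6 + x 6 * y 5)
      - (x 6 * y 7 + x 7 * y 6)) := by
  simp [bE8, CartanMatrix.E₈, Matrix.mulVec, dotProduct, Fin.sum_univ_succ]
  ring

lemma bA_e8e8ToGamma16 (x y : BT) : bA (e8e8ToGamma16 x) (e8e8ToGamma16 y) = bB x y := by
  simp only [bA, bB, bE8_eq, bU, e8e8ToGamma16, LinearMap.coe_mk, AddHom.coe_mk,
    Fin.sum_univ_succ, gammaCoord, hypCoord]
  simp
  ring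

lemma e8e8ToGamma16_injective : Function.Injective e8e8ToGamma16 := by
  rw [injective_iff_map_eq_zero]
  rintro ⟨u, p, q⟩ h
  have h1 : ∀ i j, (e8e8ToGamma16 (u, p, q)).1 i j = 0 := fun i j => by rw [h]; rfl
  have h2 : ∀ i, 2 * gammaCoord (u 0) p q i - q 0 = 0 := fun i => by
    have h3 : ((e8e8ToGamma16 (u, p, q)).2 : Fin 16 → ℚ) i = 0 := by rw [h]; rfl
    have h4 : (gammaCoord (u 0) p q i : ℚ) - q 0 / 2 = 0 := h3
    have h5 : ((2 * gammaCoord (u 0) p q i - q 0 : ℤ) : ℚ) = 0 := by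
      push_cast; linear_combination 2 * h4
    exact_mod_cast h5
  simp [Fin.forall_fin_succ, e8e8ToGamma16, gammaCoord, hypCoord] at h1 h2
  obtain ⟨⟨hE, hF⟩, hu1, hu2⟩ := h1
  obtain ⟨g0, g1, g2, g3, g4, g5, g6, g7, g8, g9, g10, g11, g12, g13, g14, g15⟩ := h2
  have q0 : q 0 = 0 := by linarith
  have u0 : u 0 0 = 0 := by linarith
  have u1 : u 0 1 = 0 := by linarith
  have p7 : p 7 = 0 := by linarith
  have p6 : p 6 = 0 := by linarith
  have p5 : p 5 = 0 := by linarith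
  have p4 : p 4 = 0 := by linarith
  have p3 : p 3 = 0 := by linarith
  have p2 : p 2 = 0 := by linarith
  have p1 : p 1 = 0 := by linarith
  have p0 : p 0 = 0 := by linarith
  have q7 : q 7 = 0 := by linarith
  have q6 : q 6 = 0 := by linarith
  have q5 : q 5 = 0 := by linarith
  have q4 : q 4 = 0 := by linarith
  have q3 : q 3 = 0 := by linarith
  have q2 : q 2 = 0 := by linarith
  have q1 : q 1 = 0 := by linarith
  refine Prod.ext ?_ (Prod.ext ?_ ?_)
  · ext i j
    fin_cases i <;> fin_cases j <;> simp [*]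
  · ext i
    fin_cases i <;> simp [*]
  · ext i
    fin_cases i <;> simp [*]

lemma e8e8ToGamma16_surjective : Function.Surjective e8e8ToGamma16 := by
  rintro ⟨w, v, h1, h2, k, hk⟩
  obtain ⟨a, ha⟩ := h1 0
  choose n hn using fun i => h2 i 0
  have hv (i) : v i = a / 2 + n i := by linear_combination hn i + ha / 2
  have hn0 : n 0 = 0 := by
    have h := hn 0
    rw [sub_self] at h
    exact_mod_cast h.symm
  have hsum : 8 * a + ∑ i, n i = 2 * k := by
    have h : (8 * a + ∑ i, n i : ℚ) = 2 * k := by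
      rw [← hk]
      simp only [hv, Finset.sum_add_distrib, Finset.sum_const, Finset.card_univ, Fintype.card_fin]
      norm_num
      ring
    exact_mod_cast h
  simp only [Fin.sum_univ_succ] at hsum
  simp at hsum
  set N := n 1 + n 2 + n 3 + n 4 + n 5 + n 6 + n 7 + n 8 with hN
  set t := w 0 0 + w 0 1 with ht
  obtain ⟨m, hm⟩ : ∃ m : Fin 16 → ℤ, ∀ i, m i = n i - 2 * t - 4 * a - N := ⟨_, fun _ => rfl⟩
  obtain ⟨q0, hq0⟩ : ∃ q0 : ℤ, q0 = -4 * t - 9 * a - 2 * N := ⟨_, rfl⟩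
  obtain ⟨s, hs⟩ : ∃ s : ℤ, s = -m 7 - m 8 := ⟨_, rfl⟩
  obtain ⟨q2, hq2⟩ : ∃ q2 : ℤ, q2 = k - 18 * a - 4 * N - 7 * t := ⟨_, rfl⟩
  obtain ⟨p0, hp0⟩ : ∃ p0 : ℤ, p0 = w 0 1 - 2 * s - q0 := ⟨_, rfl⟩
  obtain ⟨p2, hp2⟩ : ∃ p2 : ℤ, p2 = w 0 0 - 2 * s + p0 - q0 := ⟨_, rfl⟩
  let u : Fin 2 → ℤ := ![-m 7, -m 8]
  let p : Fin 8 → ℤ := ![p0, m 0 + s + p2, p2, -5 * s - m 2 - m 3 - m 4 - m 5 - m 6,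
    -4 * s - m 3 - m 4 - m 5 - m 6, -3 * s - m 4 - m 5 - m 6, -2 * s - m 5 - m 6, -s - m 6]
  let q : Fin 8 → ℤ := ![q0, q2 - m 15, q2, m 9 + m 10 + m 11 + m 12 + m 13,
    m 9 + m 10 + m 11 + m 12, m 9 + m 10 + m 11, m 9 + m 10, m 9]
  have hg (i) : gammaCoord u p q i = m i := by
    fin_cases i <;> simp [gammaCoord, u, p, q] <;> simp only [hm, hn0] at * <;> linarith
  refine ⟨(![u, w 1, w 2], p, q), Prod.ext ?_ (Subtype.ext ?_)⟩
  · ext i j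
    fin_cases i <;> fin_cases j <;> simp [e8e8ToGamma16, hypCoord, u, p, q] <;> linarith
  · funext i
    change (gammaCoord u p q i : ℚ) - (q0 : ℤ) / 2 = v i
    rw [hg, hv, hm, hq0]
    push_cast
    ring

/-- the lattices `U ⊕ U ⊕ U ⊕ Γ₁₆(-1)` and
`U ⊕ U ⊕ U ⊕ E8(-1) ⊕ E8(-1)` are isometric. -/
theorem U3Gamma16_isometric_U3E8E8 :
    ∃ e : AT ≃ₗ[ℤ] BT, ∀ x y : AT, (bB (e x) (e y) : ℚ) = bA x y := by
  let e := LinearEquiv.ofBijective e8e8ToGamma16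
    ⟨e8e8ToGamma16_injective, e8e8ToGamma16_surjective⟩
  refine ⟨e.symm, fun x y => ?_⟩
  rw [← bA_e8e8ToGamma16]
  exact congrArg₂ bA (e.apply_symm_apply x) (e.apply_symm_apply y)
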